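/- Let α = 1 and σ ∈ {−1, +1}, and let A be a compact subset of ℓ²(ℤ, ℂ). For every ε > 0 there exists N_ε ∈ ℕ such that for all N > N_ε one has Φ(A) ⊆ Φ^N(A + B(ε)), where Φ := Φ_1 = (Φ_t)|_{t=1}, Φ^N := (Φ_t^N)|_{t=1}, B(ε) := {u : ‖u‖_{L²} ≤ ε}, and A + B(ε) denotes the Minkowski sum {x + y : x ∈ A, y ∈ B(ε)}. -/

import Mathlib

open scoped BigOperators ENNReal ComplexConjugate Classical
open Filter Set MeasureTheory ComplexConjugate

noncomputable section

/-- `ℝ≥0∞`-valued `H^s` norm of a sequence of Fourier coefficients. -/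
def hsE (s : ℝ) (u : ℤ → ℂ) : ℝ≥0∞ :=
  (∑' n : ℤ, ENNReal.ofReal (1 + |(n : ℝ)| ^ (2 * s)) * (‖u n‖₊ : ℝ≥0∞) ^ 2) ^ ((1:ℝ)/2)

/-- `ℝ≥0∞`-valued `FL^{0,1}` norm. -/
def flE (u : ℤ → ℂ) : ℝ≥0∞ := ∑' n : ℤ, (‖u n‖₊ : ℝ≥0∞)

/-- real-valued `H^s` norm. -/
def hsR (s : ℝ) (u : ℤ → ℂ) : ℝ :=
  Real.sqrt (∑' n : ℤ, (1 + |(n : ℝ)| ^ (2 * s)) * ‖u n‖ ^ 2)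

/-- real-valued `FL^{0,1}` norm. -/
def flR (u : ℤ → ℂ) : ℝ := ∑' n : ℤ, ‖u n‖

/-- The condition `|j| ≤ N` for `N ∈ ℕ ∪ {∞}`. -/
def inBall (N : ℕ∞) (j : ℤ) : Prop := (j.natAbs : ℕ∞) ≤ N

/-- The resonance function `Φ_α`. -/
def res (α : ℝ) (j₁ j₂ j₃ : ℤ) : ℝ :=
  |(j₁ : ℝ)| ^ (2 * α) + |(j₂ : ℝ)| ^ (2 * α) - |(j₃ : ℝ)| ^ (2 * α)
    - |((j₁ + j₂ - j₃ : ℤ) : ℝ)| ^ (2 * α)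

/-- The (truncated) Birkhoff vector field `X_N`. -/
def XB (α σ : ℝ) (N : ℕ∞) (u : ℤ → ℂ) : ℤ → ℂ := fun n =>
  if inBall N n then
    ∑' p : ℤ × ℤ,
      (if inBall N p.1 ∧ inBall N p.2 ∧ inBall N (p.1 + p.2 - n) ∧
          res α p.1 p.2 (p.1 + p.2 - n) ≠ 0 then
        ((-σ / res α p.1 p.2 (p.1 + p.2 - n) : ℝ) : ℂ) *
          (u p.1 * u p.2 * conj (u (p.1 + p.2 - n)))
      else 0)
  else 0

/-- Truncation `Π_N`. -/
def trunc (N : ℕ) (u : ℤ → ℂ) : ℤ → ℂ := fun n => if n.natAbs ≤ N then u n else 0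

/-- Derivative of a curve at `t`, in the `H^s` norm. -/
def HasHsDerivAt (s : ℝ) (u : ℝ → ℤ → ℂ) (d : ℤ → ℂ) (t : ℝ) : Prop :=
  Tendsto (fun h : ℝ => hsE s (fun n => (u (t + h) n - u t n) / (h : ℂ) - d n))
    (nhdsWithin 0 {(0 : ℝ)}ᶜ) (nhds 0)

/-- Derivative of a curve at `t` within a set `A` of times, in the `H^s` norm. -/
def HasHsDerivWithinAt (s : ℝ) (u : ℝ → ℤ → ℂ) (d : ℤ → ℂ) (A : Set ℝ) (t : ℝ) : Prop :=
  Tendsto (fun h : ℝ => hsE s (fun n => (u (t + h) n - u t n) / (h : ℂ) - d n))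
    (nhdsWithin 0 {h : ℝ | t + h ∈ A ∧ h ≠ 0}) (nhds 0)

/-- Continuity of a curve in the `H^s` norm. -/
def ContHs (s : ℝ) (D : ℝ → ℤ → ℂ) : Prop :=
  ∀ t : ℝ, Tendsto (fun t' => hsE s (fun n => D t' n - D t n)) (nhds t) (nhds 0)

/-- Continuity of a curve in the `H^s` norm, on a set of times. -/
def ContHsOn (s : ℝ) (A : Set ℝ) (D : ℝ → ℤ → ℂ) : Prop :=
  ∀ t ∈ A, Tendsto (fun t' => hsE s (fun n => D t' n - D t n)) (nhdsWithin t A) (nhds 0)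

/-- `u` is a global-in-time solution of `d/dt u = X_N(u)`, as a curve in `H^s`. -/
def IsSol (α σ : ℝ) (N : ℕ∞) (s : ℝ) (u : ℝ → ℤ → ℂ) : Prop :=
  ∀ t : ℝ, hsE s (u t) ≠ ⊤ ∧ HasHsDerivAt s u (XB α σ N (u t)) t

/-- `u` solves `d/dt u = X_N(u)` on the set of times `A`, as a curve in `H^s`. -/
def IsSolOn (α σ : ℝ) (N : ℕ∞) (s : ℝ) (A : Set ℝ) (u : ℝ → ℤ → ℂ) : Prop :=
  ∀ t ∈ A, hsE s (u t) ≠ ⊤ ∧ HasHsDerivWithinAt s u (XB α σ N (u t)) A t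

/-- `u` is a global-in-time continuously differentiable solution, as a curve in `H^s`. -/
def IsC1Sol (α σ : ℝ) (N : ℕ∞) (s : ℝ) (u : ℝ → ℤ → ℂ) : Prop :=
  IsSol α σ N s u ∧ ContHs s (fun t => XB α σ N (u t))

/-- `u` is a continuously differentiable solution on the set of times `A`. -/
def IsC1SolOn (α σ : ℝ) (N : ℕ∞) (s : ℝ) (A : Set ℝ) (u : ℝ → ℤ → ℂ) : Prop :=
  IsSolOn α σ N s A u ∧ ContHsOn s A (fun t => XB α σ N (u t))

/-- integer modes in `[-N, N]`. -/
def Ifin (N : ℕ) : Finset ℤ := Finset.Icc (-(N:ℤ)) (N:ℤ)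

/-- The quartic form `‖Π_N u‖⁴_{L⁴}`. -/
def qL4 (N : ℕ) (u : ℤ → ℂ) : ℝ :=
  (∑ j₁ ∈ Ifin N, ∑ j₂ ∈ Ifin N, ∑ j₃ ∈ Ifin N, ∑ j₄ ∈ Ifin N,
    if j₁ + j₂ = j₃ + j₄ then u j₁ * u j₂ * conj (u j₃) * conj (u j₄) else 0).re

/-- `G_N(u)`, the derivative at `t = 0` of the energy along the truncated Birkhoff flow. -/
def GN (α σ : ℝ) (N : ℕ) (u : ℤ → ℂ) : ℝ :=
  -(σ/2) * qL4 N u + σ * (∑ j ∈ Ifin N, ‖u j‖^2)^2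
  + 2 * σ * (∑ n₁ ∈ Ifin N, ∑ n₂ ∈ Ifin N, ∑ m₁ ∈ Ifin N, ∑ m₂ ∈ Ifin N,
      if n₁ + n₂ = m₁ + m₂ then
        XB α σ (N : ℕ∞) (trunc N u) n₁ * u n₂ * conj (u m₁) * conj (u m₂)
      else 0).re


/-- The Hilbert space `ℓ²(ℤ, ℂ)`. -/
abbrev EllTwo : Type := lp (fun _ : ℤ => ℂ) 2

/-- `ℝ≥0∞`-valued sum of the squared norms of a sequence. -/
def sqSum {ι : Type*} (u : ι → ℂ) : ℝ≥0∞ := ∑' n, ‖u n‖ₑ ^ 2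

lemma sqSum_ne_top_iff (u : ℤ → ℂ) : sqSum u ≠ ⊤ ↔ Memℓp u 2 := by
  rw [memℓp_gen_iff (by norm_num), sqSum]
  have h : ∀ n, ‖u n‖ₑ ^ 2 = ((‖u n‖₊ ^ 2 : NNReal) : ℝ≥0∞) := fun n => by simp [enorm]
  simp_rw [h]
  rw [ENNReal.tsum_coe_ne_top_iff_summable, ← NNReal.summable_coe]
  simp

lemma EllTwo.summable_sq (x : EllTwo) : Summable fun n => ‖x n‖ ^ 2 := by
  simpa using (lp.memℓp x).summable (by norm_num)

lemma EllTwo.norm_sq (x : EllTwo) : ‖x‖ ^ 2 = ∑' n, ‖x n‖ ^ 2 := by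
  simpa using lp.norm_rpow_eq_tsum (p := 2) (by norm_num) x

lemma EllTwo.enorm_sq (x : EllTwo) : ‖x‖ₑ ^ 2 = sqSum x := by
  rw [sqSum, ← ofReal_norm, ← ENNReal.ofReal_pow (norm_nonneg _), EllTwo.norm_sq,
    ENNReal.ofReal_tsum_of_nonneg (fun _ => by positivity) x.summable_sq]
  refine tsum_congr fun n => ?_
  rw [ENNReal.ofReal_pow (norm_nonneg _), ofReal_norm]

lemma hsE_zero (u : ℤ → ℂ) : hsE 0 u = (2 * sqSum u) ^ ((1 : ℝ) / 2) := by
  rw [hsE, sqSum, ← ENNReal.tsum_mul_left]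
  congr 1
  refine tsum_congr fun n => ?_
  rw [mul_zero, Real.rpow_zero]
  norm_num [enorm]

lemma hsE_zero_ne_top_iff (u : ℤ → ℂ) : hsE 0 u ≠ ⊤ ↔ Memℓp u 2 := by
  rw [← sqSum_ne_top_iff, hsE_zero, Ne, ENNReal.rpow_eq_top_iff_of_pos (by norm_num),
    ENNReal.mul_eq_top]
  simp

lemma hsE_zero_coe (x : EllTwo) : hsE 0 x = ENNReal.ofReal (√2 * ‖x‖) := by
  rw [hsE_zero, ← EllTwo.enorm_sq, ENNReal.mul_rpow_of_nonneg _ _ (by norm_num),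
    ENNReal.ofReal_mul (by positivity), ofReal_norm, Real.sqrt_eq_rpow,
    ← ENNReal.ofReal_rpow_of_pos (by norm_num), ← ENNReal.rpow_natCast, ← ENNReal.rpow_mul]
  norm_num

lemma sq_tsum_mul_le {ι : Type*} (f g : ι → ℝ≥0∞) :
    (∑' i, f i * g i) ^ 2 ≤ (∑' i, f i ^ 2) * ∑' i, g i ^ 2 := by
  have key : ∑' i, f i * g i ≤
      (∑' i, f i ^ 2) ^ ((1 : ℝ) / 2) * (∑' i, g i ^ 2) ^ ((1 : ℝ) / 2) := by
    rw [ENNReal.tsum_eq_iSup_sum]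
    refine iSup_le fun s => ?_
    refine (ENNReal.inner_le_Lp_mul_Lq s f g Real.HolderConjugate.two_two).trans ?_
    simp only [ENNReal.rpow_two]
    gcongr <;> exact ENNReal.sum_le_tsum s
  calc _ ≤ ((∑' i, f i ^ 2) ^ ((1 : ℝ) / 2) * (∑' i, g i ^ 2) ^ ((1 : ℝ) / 2)) ^ 2 := by gcongr
    _ = _ := by
      rw [mul_pow, ← ENNReal.rpow_natCast, ← ENNReal.rpow_natCast, ← ENNReal.rpow_mul,
        ← ENNReal.rpow_mul]
      norm_num

/-- The linear change of variables `(n, p, q) ↦ (p, q, p + q - n)` on `ℤ³`. -/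
def freqEquiv : ℤ × ℤ × ℤ ≃ ℤ × ℤ × ℤ where
  toFun x := (x.2.1, x.2.2, x.2.1 + x.2.2 - x.1)
  invFun y := (y.1 + y.2.1 - y.2.2, y.1, y.2.1)
  left_inv x := by ext <;> simp
  right_inv y := by ext <;> simp

/-- The involution `(n, p, q) ↦ (p, n, p + q - n)` exchanging the pairs of frequencies
`{p, q}` and `{p + q - n, n}`. -/
def swapEquiv : ℤ × ℤ × ℤ ≃ ℤ × ℤ × ℤ where
  toFun x := (x.2.1, x.1, x.2.1 + x.2.2 - x.1)
  invFun x := (x.2.1, x.1, x.2.1 + x.2.2 - x.1)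
  left_inv x := by ext <;> simp
  right_inv x := by ext <;> simp

/-- The kernel `1 / ((n - p) (n - q))`, with value zero where the denominator vanishes. -/
def kern (n : ℤ) (x : ℤ × ℤ) : ℂ := ((n - x.1 : ℤ) : ℂ)⁻¹ * ((n - x.2 : ℤ) : ℂ)⁻¹

/-- The product of three coefficients entering the `n`-th mode of the cubic nonlinearity. -/
def cubicProd (u v w : ℤ → ℂ) (n : ℤ) (x : ℤ × ℤ) : ℂ := u x.1 * v x.2 * conj (w (x.1 + x.2 - n))

/-- The square of the `ℓ²` norm of the sequence `n ↦ n⁻¹`. -/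
def invSqSum : ℝ≥0∞ := sqSum fun n : ℤ => (n : ℂ)⁻¹

lemma invSqSum_ne_top : invSqSum ≠ ⊤ := by
  rw [invSqSum, sqSum_ne_top_iff, memℓp_gen_iff (by norm_num)]
  have := Real.summable_one_div_int_pow (p := 2)
  simpa using this

lemma tsum_prod_mul (f g : ℤ → ℝ≥0∞) :
    ∑' x : ℤ × ℤ, f x.1 * g x.2 = (∑' n, f n) * ∑' n, g n := by
  rw [ENNReal.tsum_prod', ← ENNReal.tsum_mul_right]
  exact tsum_congr fun a => ENNReal.tsum_mul_left (a := f a) (f := g)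

lemma sqSum_kern (n : ℤ) : sqSum (kern n) = invSqSum ^ 2 := by
  have h (n : ℤ) : ∑' p : ℤ, ‖((n - p : ℤ) : ℂ)⁻¹‖ₑ ^ 2 = invSqSum :=
    (Equiv.subLeft n).tsum_eq fun p : ℤ => ‖((p : ℤ) : ℂ)⁻¹‖ₑ ^ 2
  simp only [sqSum, kern, enorm_mul, mul_pow]
  rw [tsum_prod_mul (fun p => ‖((n - p : ℤ) : ℂ)⁻¹‖ₑ ^ 2)
    (fun p => ‖((n - p : ℤ) : ℂ)⁻¹‖ₑ ^ 2), h, sq]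

lemma tsum_sqSum_cubicProd (u v w : ℤ → ℂ) :
    ∑' n, sqSum (cubicProd u v w n) = sqSum u * sqSum v * sqSum w := by
  simp only [sqSum]
  rw [← ENNReal.tsum_prod (f := fun n x => ‖cubicProd u v w n x‖ₑ ^ 2)]
  have := freqEquiv.tsum_eq fun y : ℤ × ℤ × ℤ => ‖u y.1‖ₑ ^ 2 * (‖v y.2.1‖ₑ ^ 2 * ‖w y.2.2‖ₑ ^ 2)
  rw [ENNReal.tsum_prod'] at this
  rw [ENNReal.tsum_prod']
  convert this using 1
  · simp [cubicProd, freqEquiv, mul_pow, mul_assoc]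
  · rw [ENNReal.tsum_prod']
    simp only [ENNReal.tsum_mul_left, ENNReal.tsum_mul_right]
    rw [tsum_prod_mul (fun n => ‖v n‖ₑ ^ 2) (fun n => ‖w n‖ₑ ^ 2), mul_assoc]

lemma tsum_sq_tsum_enorm_le (u v w : ℤ → ℂ) :
    ∑' n, (∑' x, ‖kern n x * cubicProd u v w n x‖ₑ) ^ 2 ≤
      invSqSum ^ 2 * (sqSum u * sqSum v * sqSum w) := by
  rw [← tsum_sqSum_cubicProd, ← ENNReal.tsum_mul_left]
  refine ENNReal.tsum_le_tsum fun n => ?_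
  simp only [enorm_mul]
  rw [← sqSum_kern n]
  exact sq_tsum_mul_le _ _

lemma EllTwo.tsum_sq_ne_top (u v w : EllTwo) :
    ∑' n, (∑' x, ‖kern n x * cubicProd u v w n x‖ₑ) ^ 2 ≠ ⊤ := by
  refine ne_top_of_le_ne_top ?_ (tsum_sq_tsum_enorm_le u v w)
  simp only [← EllTwo.enorm_sq]
  finiteness [invSqSum_ne_top]

lemma EllTwo.summable_cubic (u v w : EllTwo) (n : ℤ) :
    Summable fun x => kern n x * cubicProd u v w n x := by
  have := ENNReal.ne_top_of_tsum_ne_top (EllTwo.tsum_sq_ne_top u v w) n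
  exact .of_enorm fun h => this (by rw [h]; rfl)

/-- The trilinear operator underlying the Birkhoff vector field for `α = 1`. -/
def trilin (u v w : EllTwo) : EllTwo :=
  ⟨fun n => ∑' x, kern n x * cubicProd u v w n x, (sqSum_ne_top_iff _).1 <|
    ne_top_of_le_ne_top (EllTwo.tsum_sq_ne_top u v w) <| ENNReal.tsum_le_tsum fun _ => by
      gcongr
      exact enorm_tsum_le_tsum_enorm⟩

lemma trilin_apply (u v w : EllTwo) (n : ℤ) :
    trilin u v w n = ∑' x, kern n x * cubicProd u v w n x := rfl

lemma norm_trilin_le (u v w : EllTwo) :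
    ‖trilin u v w‖ ≤ invSqSum.toReal * (‖u‖ * ‖v‖ * ‖w‖) := by
  have h : ‖trilin u v w‖ₑ ^ 2 ≤ (invSqSum * (‖u‖ₑ * ‖v‖ₑ * ‖w‖ₑ)) ^ 2 := by
    rw [EllTwo.enorm_sq, mul_pow, mul_pow, mul_pow, EllTwo.enorm_sq, EllTwo.enorm_sq,
      EllTwo.enorm_sq]
    refine le_trans (ENNReal.tsum_le_tsum fun n => ?_) (tsum_sq_tsum_enorm_le u v w)
    gcongr
    exact enorm_tsum_le_tsum_enorm
  have h' := (ENNReal.pow_le_pow_left_iff two_ne_zero).1 h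
  have := ENNReal.toReal_mono (by finiteness [invSqSum_ne_top]) h'
  simpa [ENNReal.toReal_mul] using this

lemma trilin_sub_left (u u' v w : EllTwo) :
    trilin (u - u') v w = trilin u v w - trilin u' v w := by
  ext n
  rw [lp.coeFn_sub, Pi.sub_apply, trilin_apply, trilin_apply, trilin_apply,
    ← (EllTwo.summable_cubic u v w n).tsum_sub (EllTwo.summable_cubic u' v w n)]
  refine tsum_congr fun x => ?_
  simp only [cubicProd, lp.coeFn_sub, Pi.sub_apply]
  ring

lemma trilin_sub_middle (u v v' w : EllTwo) :
    trilin u (v - v') w = trilin u v w - trilin u v' w := by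
  ext n
  rw [lp.coeFn_sub, Pi.sub_apply, trilin_apply, trilin_apply, trilin_apply,
    ← (EllTwo.summable_cubic u v w n).tsum_sub (EllTwo.summable_cubic u v' w n)]
  refine tsum_congr fun x => ?_
  simp only [cubicProd, lp.coeFn_sub, Pi.sub_apply]
  ring

lemma trilin_sub_right (u v w w' : EllTwo) :
    trilin u v (w - w') = trilin u v w - trilin u v w' := by
  ext n
  rw [lp.coeFn_sub, Pi.sub_apply, trilin_apply, trilin_apply, trilin_apply,
    ← (EllTwo.summable_cubic u v w n).tsum_sub (EllTwo.summable_cubic u v w' n)]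
  refine tsum_congr fun x => ?_
  simp only [cubicProd, lp.coeFn_sub, Pi.sub_apply, map_sub]
  ring

lemma norm_trilin_diag_sub_le {R : ℝ} {u v : EllTwo} (hu : ‖u‖ ≤ R) (hv : ‖v‖ ≤ R) :
    ‖trilin u u u - trilin v v v‖ ≤ 3 * invSqSum.toReal * R ^ 2 * ‖u - v‖ := by
  have hR : 0 ≤ R := (norm_nonneg u).trans hu
  have hC : 0 ≤ invSqSum.toReal := ENNReal.toReal_nonneg
  have key : trilin u u u - trilin v v v =
      trilin (u - v) u u + trilin v (u - v) u + trilin v v (u - v) := by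
    rw [trilin_sub_left, trilin_sub_middle, trilin_sub_right]
    abel
  have h₁ : ‖trilin (u - v) u u‖ ≤ invSqSum.toReal * (‖u - v‖ * R * R) :=
    (norm_trilin_le _ _ _).trans (by gcongr)
  have h₂ : ‖trilin v (u - v) u‖ ≤ invSqSum.toReal * (R * ‖u - v‖ * R) :=
    (norm_trilin_le _ _ _).trans (by gcongr)
  have h₃ : ‖trilin v v (u - v)‖ ≤ invSqSum.toReal * (R * R * ‖u - v‖) :=
    (norm_trilin_le _ _ _).trans (by gcongr)
  rw [key]
  refine norm_add₃_le.trans ?_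
  linarith

lemma EllTwo.summable_quartic (u : EllTwo) : Summable fun y : ℤ × ℤ × ℤ =>
    kern y.1 y.2 * cubicProd u u u y.1 y.2 * starRingEnd ℂ (u y.1) := by
  refine .of_enorm ?_
  rw [ENNReal.tsum_prod']
  simp only [enorm_mul _ (starRingEnd ℂ _), ENNReal.tsum_mul_right, RCLike.enorm_conj]
  intro h
  have h' := sq_tsum_mul_le (fun n => ∑' x, ‖kern n x * cubicProd u u u n x‖ₑ) fun n => ‖u n‖ₑ
  rw [h] at h'
  refine ne_top_of_le_ne_top (ENNReal.mul_ne_top (EllTwo.tsum_sq_ne_top u u u) ?_) h' rfl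
  exact (sqSum_ne_top_iff _).2 (lp.memℓp u)

lemma inner_trilin_diag (u : EllTwo) : inner ℝ u (trilin u u u) = 0 := by
  set F : ℤ × ℤ × ℤ → ℂ :=
    fun y => kern y.1 y.2 * cubicProd u u u y.1 y.2 * starRingEnd ℂ (u y.1) with hF
  have hs : Summable F := EllTwo.summable_quartic u
  have hswap (y) : F (swapEquiv y) = -conj (F y) := by
    obtain ⟨n, p, q⟩ := y
    have e₁ : p - (p + q - n) = n - q := by ring
    have e₂ : n + (p + q - n) - p = q := by ring
    have e₃ : p - n = -(n - p) := by ring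
    simp only [hF, swapEquiv, Equiv.coe_fn_mk, kern, cubicProd, e₁, e₂, e₃, map_mul,
      Complex.conj_conj, map_inv₀, map_intCast, Int.cast_neg, inv_neg]
    ring
  have hre : (∑' y, F y).re = 0 := by
    have h := swapEquiv.tsum_eq F
    simp only [hswap, tsum_neg] at h
    rw [← Complex.conj_tsum] at h
    have := congrArg Complex.re h
    simp only [Complex.neg_re, Complex.conj_re] at this
    linarith
  have hT (n : ℤ) : ∑' x, F (n, x) = trilin u u u n * starRingEnd ℂ (u n) := by
    simp only [hF, trilin_apply, tsum_mul_right]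
  have hF' : ∑' y, F y = ∑' n, trilin u u u n * starRingEnd ℂ (u n) := by
    rw [hs.tsum_prod]
    exact tsum_congr hT
  have hs' : Summable fun n => trilin u u u n * starRingEnd ℂ (u n) := by
    simpa only [hT] using hs.prod
  rw [lp.inner_eq_tsum]
  simp only [Complex.inner]
  exact (Complex.re_tsum hs').symm.trans (hF' ▸ hre)

/-- The frequency cutoff `Π_N` as a map on `ℓ²`. -/
def cutoff (N : ℕ∞) (u : EllTwo) : EllTwo :=
  ⟨fun n => if inBall N n then u n else 0, (lp.memℓp u).mono' fun n => by
    split_ifs <;> simp⟩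

lemma cutoff_apply (N : ℕ∞) (u : EllTwo) (n : ℤ) :
    cutoff N u n = if inBall N n then u n else 0 := rfl

lemma cutoff_top (u : EllTwo) : cutoff ⊤ u = u := by
  ext n
  simp [cutoff_apply, inBall]

lemma norm_cutoff_le (N : ℕ∞) (u : EllTwo) : ‖cutoff N u‖ ≤ ‖u‖ :=
  lp.norm_mono two_ne_zero fun n => by
    rw [cutoff_apply]
    split_ifs <;> simp

lemma cutoff_sub (N : ℕ∞) (u v : EllTwo) : cutoff N (u - v) = cutoff N u - cutoff N v := by
  ext n
  simp only [cutoff_apply, lp.coeFn_sub, Pi.sub_apply]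
  split_ifs <;> simp

lemma inner_cutoff_right (N : ℕ∞) (u v : EllTwo) :
    inner ℝ u (cutoff N v) = inner ℝ (cutoff N u) v := by
  rw [lp.inner_eq_tsum, lp.inner_eq_tsum]
  refine tsum_congr fun n => ?_
  rw [cutoff_apply, cutoff_apply]
  split_ifs <;> simp

lemma tendsto_cutoff (u : EllTwo) : Tendsto (fun N : ℕ => cutoff N u) atTop (nhds u) := by
  have h : Tendsto (fun N : ℕ => ‖cutoff N u - u‖ ^ 2) atTop (nhds 0) := by
    simp only [EllTwo.norm_sq]
    rw [← tsum_zero (α := ℝ) (β := ℤ)]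
    refine tendsto_tsum_of_dominated_convergence u.summable_sq (fun n => ?_)
      (.of_forall fun N n => ?_)
    · refine tendsto_const_nhds.congr' ?_
      filter_upwards [eventually_ge_atTop n.natAbs] with N hN
      have : inBall N n := by simpa [inBall] using hN
      simp [cutoff_apply, this]
    · rw [lp.coeFn_sub, Pi.sub_apply, cutoff_apply]
      split_ifs <;> simp
  rw [tendsto_iff_norm_sub_tendsto_zero]
  simpa using h.sqrt

/-- The (truncated) Birkhoff vector field for `α = 1` as a map on `ℓ²`. -/
def birkhoff (σ : ℝ) (N : ℕ∞) (u : EllTwo) : EllTwo :=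
  (σ / 2) • cutoff N (trilin (cutoff N u) (cutoff N u) (cutoff N u))

lemma res_one (p q n : ℤ) : res 1 p q (p + q - n) = -2 * ((n - p : ℤ) : ℝ) * ((n - q : ℤ) : ℝ) := by
  have h (x : ℝ) : |x| ^ (2 * (1 : ℝ)) = x ^ 2 := by
    rw [mul_one, Real.rpow_two, sq_abs]
  simp only [res, h]
  push_cast
  ring

lemma coe_birkhoff (σ : ℝ) (N : ℕ∞) (u : EllTwo) : ⇑(birkhoff σ N u) = XB 1 σ N u := by
  ext n
  rw [birkhoff, lp.coeFn_smul, Pi.smul_apply, cutoff_apply, XB]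
  split_ifs with hn
  swap
  · simp
  rw [trilin_apply, Complex.real_smul, ← tsum_mul_left]
  refine tsum_congr fun ⟨p, q⟩ => ?_
  simp only [res_one, cubicProd, cutoff_apply, kern]
  by_cases h₁ : inBall N p <;> by_cases h₂ : inBall N q <;> by_cases h₃ : inBall N (p + q - n) <;>
    simp only [h₁, h₂, h₃, if_true, if_false, true_and, false_and, and_false, map_zero,
      mul_zero, zero_mul]
  by_cases h : -2 * ((n - p : ℤ) : ℝ) * ((n - q : ℤ) : ℝ) = 0
  · have h' : (n - p : ℤ) = 0 ∨ (n - q : ℤ) = 0 := by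
      simpa only [mul_eq_zero, neg_eq_zero, two_ne_zero, false_or, Int.cast_eq_zero] using h
    rcases h' with h' | h' <;> simp [h']
  · rw [if_pos h]
    push_cast
    simp only [neg_mul, div_eq_mul_inv, mul_inv, inv_neg]
    ring

lemma norm_birkhoff_sub_le {σ R : ℝ} (hσ : |σ| ≤ 1) (N : ℕ∞) {u v : EllTwo}
    (hu : ‖u‖ ≤ R) (hv : ‖v‖ ≤ R) :
    ‖birkhoff σ N u - birkhoff σ N v‖ ≤ 3 * invSqSum.toReal * R ^ 2 * ‖u - v‖ := by
  have hR : 0 ≤ R := (norm_nonneg u).trans hu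
  have hC : 0 ≤ invSqSum.toReal := ENNReal.toReal_nonneg
  rw [birkhoff, birkhoff, ← smul_sub, ← cutoff_sub, norm_smul, Real.norm_eq_abs]
  have h₁ : |σ / 2| ≤ 1 := by
    rw [abs_div, abs_two]
    linarith [abs_nonneg σ]
  refine (mul_le_of_le_one_left (norm_nonneg _) h₁).trans ?_
  refine (norm_cutoff_le _ _).trans ?_
  refine (norm_trilin_diag_sub_le ((norm_cutoff_le N u).trans hu)
    ((norm_cutoff_le N v).trans hv)).trans ?_
  rw [← cutoff_sub]
  gcongr
  exact norm_cutoff_le _ _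

lemma inner_birkhoff (σ : ℝ) (N : ℕ∞) (u : EllTwo) : inner ℝ u (birkhoff σ N u) = 0 := by
  rw [birkhoff, inner_smul_right, inner_cutoff_right, inner_trilin_diag, mul_zero]

lemma lipschitzOnWith_birkhoff {σ : ℝ} (hσ : |σ| ≤ 1) (N : ℕ∞) (R : ℝ) :
    LipschitzOnWith (3 * invSqSum.toReal * R ^ 2).toNNReal (birkhoff σ N)
      (Metric.closedBall 0 R) := by
  refine LipschitzOnWith.of_dist_le_mul fun u hu v hv => ?_
  rw [dist_eq_norm, dist_eq_norm, Real.coe_toNNReal _ (by positivity)]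
  exact norm_birkhoff_sub_le hσ N (mem_closedBall_zero_iff.1 hu) (mem_closedBall_zero_iff.1 hv)

lemma birkhoff_eq_cutoff (σ : ℝ) (N : ℕ∞) (u : EllTwo) :
    birkhoff σ N u = cutoff N (birkhoff σ ⊤ (cutoff N u)) := by
  ext n
  simp only [birkhoff, cutoff_top, cutoff_apply, lp.coeFn_smul, Pi.smul_apply, smul_ite, smul_zero]

lemma eventually_norm_cutoff_sub_le {K : Set EllTwo} (hK : IsCompact K) {ε : ℝ} (hε : 0 < ε) :
    ∀ᶠ N : ℕ in atTop, ∀ u ∈ K, ‖cutoff N u - u‖ ≤ ε := by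
  obtain ⟨s, hs, hKs⟩ := Metric.totallyBounded_iff.1 hK.totallyBounded (ε / 3) (by positivity)
  have h : ∀ᶠ N : ℕ in atTop, ∀ v ∈ s, dist (cutoff N v) v < ε / 3 :=
    (hs.eventually_all).2 fun v _ => Metric.tendsto_nhds.1 (tendsto_cutoff v) _ (by positivity)
  filter_upwards [h] with N hN u hu
  obtain ⟨v, hv, huv⟩ := mem_iUnion₂.1 (hKs hu)
  have h₁ := hN v hv
  have h₂ := norm_cutoff_le N (u - v)
  rw [Metric.mem_ball] at huv
  rw [cutoff_sub, ← dist_eq_norm, ← dist_eq_norm] at h₂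
  rw [← dist_eq_norm]
  have h₃ := dist_triangle4 (cutoff N u) (cutoff N v) v u
  rw [dist_comm v u] at h₃
  linarith

lemma eventually_norm_birkhoff_sub_le {σ : ℝ} (hσ : |σ| ≤ 1) {K : Set EllTwo} (hK : IsCompact K)
    {ε : ℝ} (hε : 0 < ε) :
    ∀ᶠ N : ℕ in atTop, ∀ u ∈ K, ‖birkhoff σ N u - birkhoff σ ⊤ u‖ ≤ ε := by
  obtain ⟨R, hR⟩ := hK.isBounded.exists_norm_le
  set L := 3 * invSqSum.toReal * R ^ 2
  have hL0 : 0 ≤ L := by positivity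
  have hK' : IsCompact (birkhoff σ ⊤ '' K) :=
    hK.image_of_continuousOn <| (lipschitzOnWith_birkhoff hσ ⊤ R).continuousOn.mono fun u hu =>
      mem_closedBall_zero_iff.2 (hR u hu)
  filter_upwards [eventually_norm_cutoff_sub_le hK (ε := ε / (2 * (L + 1))) (by positivity),
    eventually_norm_cutoff_sub_le hK' (ε := ε / 2) (by positivity)] with N h₁ h₂ u hu
  have h₃ : ‖cutoff N (birkhoff σ ⊤ (cutoff N u) - birkhoff σ ⊤ u)‖ ≤ L * ‖cutoff N u - u‖ :=
    (norm_cutoff_le _ _).trans <|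
      norm_birkhoff_sub_le hσ ⊤ ((norm_cutoff_le N u).trans (hR u hu)) (hR u hu)
  have h₄ : L * ‖cutoff N u - u‖ ≤ ε / 2 := by
    calc L * ‖cutoff N u - u‖ ≤ (L + 1) * (ε / (2 * (L + 1))) := by
          gcongr
          · linarith
          · exact h₁ u hu
      _ = ε / 2 := by field_simp
  have h₅ := h₂ _ (mem_image_of_mem _ hu)
  rw [birkhoff_eq_cutoff, ← sub_add_sub_cancel _ (cutoff N (birkhoff σ ⊤ u)), ← cutoff_sub]
  refine (norm_add_le _ _).trans ?_
  linarith

/-- `f` is an integral curve of the (truncated) Birkhoff vector field. -/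
def IsBirkhoffCurve (σ : ℝ) (N : ℕ∞) (f : ℝ → EllTwo) : Prop :=
  ∀ t, HasDerivAt f (birkhoff σ N (f t)) t

namespace IsBirkhoffCurve

variable {σ : ℝ} {M N : ℕ∞} {f g : ℝ → EllTwo}

lemma comp_const_sub (hf : IsBirkhoffCurve σ N f) (c : ℝ) :
    IsBirkhoffCurve (-σ) N fun t => f (c - t) := fun t => by
  have h := (hf (c - t)).scomp t ((hasDerivAt_id t).const_sub c)
  simpa [Function.comp_def, birkhoff, neg_div] using h

lemma comp_sub_const (hf : IsBirkhoffCurve σ N f) (c : ℝ) :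
    IsBirkhoffCurve σ N fun t => f (t - c) := fun t => (hf (t - c)).comp_sub_const t c

lemma continuous (hf : IsBirkhoffCurve σ N f) : Continuous f :=
  continuous_iff_continuousAt.2 fun t => (hf t).continuousAt

lemma norm_eq (hf : IsBirkhoffCurve σ N f) (s t : ℝ) : ‖f s‖ = ‖f t‖ := by
  have h (t : ℝ) : HasDerivAt (‖f ·‖ ^ 2) 0 t := by
    simpa [inner_birkhoff] using (hf t).norm_sq
  have := is_const_of_deriv_eq_zero (fun t => (h t).differentiableAt) (fun t => (h t).deriv) s t
  exact (pow_left_inj₀ (norm_nonneg _) (norm_nonneg _) two_ne_zero).1 this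

lemma dist_le {R δ : ℝ} (hσ : |σ| ≤ 1) (hf : IsBirkhoffCurve σ M f) (hg : IsBirkhoffCurve σ N g)
    (hfR : ‖f 0‖ ≤ R) (hgR : ‖g 0‖ ≤ R)
    (hδ : ∀ t ∈ Icc (0 : ℝ) 1, ‖birkhoff σ N (f t) - birkhoff σ M (f t)‖ ≤ δ)
    {t : ℝ} (ht : t ∈ Icc (0 : ℝ) 1) :
    dist (f t) (g t) ≤
      gronwallBound (dist (f 0) (g 0)) (3 * invSqSum.toReal * R ^ 2).toNNReal δ t := by
  have h := dist_le_of_approx_trajectories_ODE_of_mem (v := fun _ => birkhoff σ N)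
    (s := fun _ => Metric.closedBall 0 R) (a := 0) (b := 1) (εf := δ) (εg := 0)
    (fun t _ => lipschitzOnWith_birkhoff hσ N R)
    hf.continuous.continuousOn (fun t _ => (hf t).hasDerivWithinAt)
    (fun t ht => by
      rw [dist_comm, dist_eq_norm]
      exact hδ t (Ico_subset_Icc_self ht))
    (fun t _ => mem_closedBall_zero_iff.2 ((hf.norm_eq t 0).trans_le hfR))
    hg.continuous.continuousOn (fun t _ => (hg t).hasDerivWithinAt)
    (fun t _ => (dist_self _).le)
    (fun t _ => mem_closedBall_zero_iff.2 ((hg.norm_eq t 0).trans_le hgR))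
    le_rfl t ht
  simpa using h

lemma eq_of_eq_zero (hσ : |σ| ≤ 1) (hf : IsBirkhoffCurve σ N f) (hg : IsBirkhoffCurve σ N g)
    (h : f 0 = g 0) : f 1 = g 1 := by
  have := hf.dist_le (δ := 0) hσ hg le_rfl (congrArg norm h).ge (fun t _ => by simp)
    (right_mem_Icc.2 zero_le_one)
  rw [h, dist_self, gronwallBound_ε0_δ0] at this
  exact dist_le_zero.1 this

end IsBirkhoffCurve

lemma IsSol.exists_isBirkhoffCurve {σ : ℝ} {N : ℕ∞} {u : ℝ → ℤ → ℂ} (hu : IsSol 1 σ N 0 u) :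
    ∃ f : ℝ → EllTwo, (∀ t, ⇑(f t) = u t) ∧ IsBirkhoffCurve σ N f := by
  refine ⟨fun t => ⟨u t, (hsE_zero_ne_top_iff _).1 (hu t).1⟩, fun t => rfl, fun t => ?_⟩
  set f : ℝ → EllTwo := fun t => ⟨u t, (hsE_zero_ne_top_iff _).1 (hu t).1⟩ with hf
  rw [hasDerivAt_iff_tendsto_slope_zero, tendsto_iff_norm_sub_tendsto_zero]
  have h := (ENNReal.tendsto_toReal ENNReal.zero_ne_top).comp (hu t).2
  refine squeeze_zero (fun _ => norm_nonneg _) (fun e => ?_) h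
  have hcoe : (fun n => (u (t + e) n - u t n) / (e : ℂ) - XB 1 σ N (u t) n) =
      ⇑(e⁻¹ • (f (t + e) - f t) - birkhoff σ N (f t)) := by
    ext n
    rw [lp.coeFn_sub, coe_birkhoff, lp.coeFn_smul, lp.coeFn_sub]
    simp [hf, div_eq_inv_mul]
  rw [Function.comp_apply, hcoe, hsE_zero_coe, ENNReal.toReal_ofReal (by positivity)]
  exact le_mul_of_one_le_left (norm_nonneg _) (Real.one_le_sqrt.2 one_le_two)

/-- For `α = 1` and a compact `A ⊆ ℓ²`: for `N` large, `Φ(A) ⊆ Φ^N(A + B(ε))`, where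
`Φ = Φ_1`, `Φ^N = Φ_1^N` and `B(ε)` is the closed `L²`-ball of radius `ε`. -/
theorem statement_7 (σ : ℝ) (hσ : σ = 1 ∨ σ = -1)
    (A : Set (lp (fun _ : ℤ => ℂ) 2)) (hA : IsCompact A)
    (S : ℝ → (ℤ → ℂ) → ℤ → ℂ) (SN : ℕ → ℝ → (ℤ → ℂ) → ℤ → ℂ)
    (hS : ∀ u₀ : ℤ → ℂ, hsE 0 u₀ ≠ ⊤ →
      IsSol 1 σ ⊤ 0 (fun t => S t u₀) ∧ S 0 u₀ = u₀)
    (hSN : ∀ N : ℕ, ∀ u₀ : ℤ → ℂ, hsE 0 u₀ ≠ ⊤ →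
      IsSol 1 σ (N : ℕ∞) 0 (fun t => SN N t u₀) ∧ SN N 0 u₀ = u₀) :
    ∀ ε : ℝ, 0 < ε → ∃ N₀ : ℕ, ∀ N : ℕ, N₀ < N →
      ∀ a ∈ A, ∃ x ∈ A, ∃ y : ℤ → ℂ, hsE 0 y ≤ ENNReal.ofReal ε ∧
        S 1 ⇑a = SN N 1 (fun n => x n + y n) := by
  intro ε hε
  have hσ₁ : |σ| ≤ 1 := by rcases hσ with rfl | rfl <;> simp
  have hσ₂ : |-σ| ≤ 1 := by rwa [abs_neg]
  have htop (u : EllTwo) : hsE 0 u ≠ ⊤ := (hsE_zero_ne_top_iff _).2 (lp.memℓp u)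
  choose f hfS hf using fun u : EllTwo => (hS u (htop u)).1.exists_isBirkhoffCurve
  choose g hgS hg using fun (N : ℕ) (u : EllTwo) => (hSN N u (htop u)).1.exists_isBirkhoffCurve
  have hf0 (u : EllTwo) : f u 0 = u := lp.ext ((hfS u 0).trans (hS u (htop u)).2)
  have hg0 (N : ℕ) (u : EllTwo) : g N u 0 = u := lp.ext ((hgS N u 0).trans (hSN N u (htop u)).2)
  obtain ⟨R, hR⟩ := hA.isBounded.exists_norm_le
  set L : NNReal := (3 * invSqSum.toReal * R ^ 2).toNNReal
  obtain ⟨η, hη, hηε⟩ : ∃ η : ℝ, 0 < η ∧ √2 * gronwallBound 0 L η 1 ≤ ε := by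
    have hlim : Tendsto (fun η => √2 * gronwallBound 0 L η 1) (nhdsWithin 0 (Ioi 0)) (nhds 0) := by
      have := ((gronwallBound_continuous_ε 0 L 1).const_mul √2).tendsto 0
      rw [gronwallBound_ε0_δ0, mul_zero] at this
      exact this.mono_left nhdsWithin_le_nhds
    obtain ⟨η, h₁, h₂⟩ := ((hlim.eventually_lt_const hε).and self_mem_nhdsWithin).exists
    exact ⟨η, h₂, h₁.le⟩
  have hcont : ContinuousOn (fun p : ℝ × EllTwo => f p.2 p.1) (Icc 0 1 ×ˢ A) := by
    refine continuousOn_prod_of_continuousOn_lipschitzOnWith' _ (Real.exp L).toNNReal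
      (fun t ht => LipschitzOnWith.of_dist_le_mul fun a ha b hb => ?_)
      (fun a _ => (hf a).continuous.continuousOn)
    have h := (hf a).dist_le (δ := 0) hσ₁ (hf b) ((hf0 a).symm ▸ hR a ha) ((hf0 b).symm ▸ hR b hb)
      (fun t _ => by simp) ht
    rw [hf0, hf0, gronwallBound_ε0] at h
    refine h.trans ?_
    rw [mul_comm, Real.coe_toNNReal _ (Real.exp_nonneg _)]
    gcongr
    exact mul_le_of_le_one_right L.2 ht.2
  have hK := (isCompact_Icc.prod hA).image_of_continuousOn hcont
  obtain ⟨N₀, hN₀⟩ := eventually_atTop.1 (eventually_norm_birkhoff_sub_le hσ₂ hK hη)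
  refine ⟨N₀, fun N hN a ha => ?_⟩
  set b := f a 1 with hb
  set w := g N b (-1) with hw
  refine ⟨a, ha, ⇑(w - a), ?_, ?_⟩
  · rw [hsE_zero_coe]
    refine ENNReal.ofReal_le_ofReal (le_trans ?_ hηε)
    have hbR : ‖b‖ ≤ R := by
      rw [hb, (hf a).norm_eq 1 0, hf0]
      exact hR a ha
    have h := ((hf a).comp_const_sub 1).dist_le (R := R) (δ := η) hσ₂ ((hg N b).comp_const_sub 0)
      (by simpa using hbR) (by simpa [hg0] using hbR)
      (fun t ht => hN₀ N hN.le _ ⟨(1 - t, a), ⟨⟨by linarith [ht.2], by linarith [ht.1]⟩, ha⟩, rfl⟩)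
      (right_mem_Icc.2 zero_le_one)
    simp only [sub_self, sub_zero, zero_sub, hf0, hg0, ← hb, ← hw, dist_self] at h
    rw [← dist_eq_norm, dist_comm]
    gcongr
  · have hsum : (fun n => a n + (w - a) n) = ⇑w := by
      ext n
      simp
    rw [hsum, ← hfS, ← hgS]
    have h := (hg N w).eq_of_eq_zero hσ₁ ((hg N b).comp_sub_const 1) (by simp [hg0, hw])
    rw [h, sub_self, hg0]

end
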